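/- Let n ≥ 1 and let W : ℝⁿ → ℂ be such that there exists w ∈ L¹(ℝⁿ) with W(x) = ∫_{ℝⁿ} w(ξ) e^{2πi x·ξ} dξ for almost every x (so W is the inverse Fourier transform of an integrable function, and in particular W is essentially bounded by ‖w‖_{L¹}). For t ∈ ℝ let U_t denote the free Schrödinger propagator e^{iΔt}, i.e. the unitary operator on L²(ℝⁿ) given by the Fourier multiplier with symbol e^{-4π² i t |ξ|²} (equivalently, U_t f = F⁻¹( e^{-4π² i t|ξ|²} F f ) where F is the Fourier–Plancherel transform on L²). Then for every t ∈ ℝ, every 1 ≤ p < ∞ and every f ∈ L²(ℝⁿ) ∩ Lᵖ(ℝⁿ), the function U_{-t}(W · U_t f) (which belongs to L² since W is bounded) also belongs to Lᵖ(ℝⁿ) and satisfies ‖U_{-t}(W · U_t f)‖_{Lᵖ} ≤ ‖w‖_{L¹} ‖f‖_{Lᵖ}. -/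

import Mathlib

open MeasureTheory Real Complex
open scoped ENNReal FourierTransform SchwartzMap Convolution

section Oscillation

/-- The function `x ↦ e^{ix}` has temperate growth. -/
theorem hasTemperateGrowth_cexp_ofReal_mul_I :
    Function.HasTemperateGrowth (fun x : ℝ => cexp (x * I)) := by
  have hderiv : ∀ x : ℝ, HasDerivAt (fun x : ℝ => cexp (x * I)) (I * cexp (x * I)) x := by
    intro x
    have h := ((Complex.ofRealCLM.hasDerivAt (x := x)).mul_const I).cexp
    simpa [mul_comm] using h
  have hiter : ∀ k : ℕ, iteratedDeriv k (fun x : ℝ => cexp (x * I)) =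
      fun x : ℝ => I ^ k * cexp (x * I) := by
    intro k
    induction k with
    | zero => simp
    | succ k ih =>
      rw [iteratedDeriv_succ, ih]
      ext x
      rw [((hderiv x).const_mul (I ^ k)).deriv, pow_succ, mul_assoc]
  refine ⟨(Complex.ofRealCLM.contDiff.mul contDiff_const).cexp, fun k => ⟨0, 1, fun x => ?_⟩⟩
  rw [norm_iteratedFDeriv_eq_norm_iteratedDeriv, hiter]
  simp [Complex.norm_exp_ofReal_mul_I]

variable {V : Type*} [NormedAddCommGroup V] [InnerProductSpace ℝ V]

/-- The symbol `e^{-4π² i t |ξ|²}` of the free Schrödinger propagator. -/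
noncomputable def schrodingerSymbol {V : Type*} [NormedAddCommGroup V] (t : ℝ) (ξ : V) : ℂ :=
  cexp ((((-4) * π ^ 2 * t * ‖ξ‖ ^ 2 : ℝ) : ℂ) * I)

theorem hasTemperateGrowth_schrodingerSymbol (t : ℝ) :
    Function.HasTemperateGrowth (schrodingerSymbol (V := V) t) := by
  refine hasTemperateGrowth_cexp_ofReal_mul_I.comp
    (f := fun ξ : V => (-4) * π ^ 2 * t * ‖ξ‖ ^ 2) ?_
  exact (Function.HasTemperateGrowth.const _).mul (Function.hasTemperateGrowth_norm_sq V)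

theorem continuous_schrodingerSymbol (t : ℝ) : Continuous (schrodingerSymbol (V := V) t) :=
  (hasTemperateGrowth_schrodingerSymbol t).1.continuous

theorem norm_schrodingerSymbol {V : Type*} [NormedAddCommGroup V] (t : ℝ) (ξ : V) : ‖schrodingerSymbol t ξ‖ = 1 :=
  Complex.norm_exp_ofReal_mul_I _

/-- The phase picked up by conjugating the modulation of frequency `η` by the propagator. -/
noncomputable def modulationPhase (t : ℝ) (x η : V) : ℂ :=
  cexp (((2 * π * inner ℝ x η + 4 * π ^ 2 * t * ‖η‖ ^ 2 : ℝ) : ℂ) * I)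

theorem norm_modulationPhase (t : ℝ) (x η : V) : ‖modulationPhase t x η‖ = 1 :=
  Complex.norm_exp_ofReal_mul_I _

theorem continuous_modulationPhase (t : ℝ) :
    Continuous fun q : V × V => modulationPhase t q.1 q.2 := by
  unfold modulationPhase
  fun_prop

theorem schrodingerSymbol_neg_mul_shift (t : ℝ) (x ζ η : V) :
    𝐞 (inner ℝ (ζ + η) x) * (schrodingerSymbol (-t) (ζ + η) * schrodingerSymbol t ζ) =
      modulationPhase t x η * 𝐞 (inner ℝ ζ (x + (4 * π * t) • η)) := by
  simp only [schrodingerSymbol, modulationPhase, Real.fourierChar_apply, ← Complex.exp_add,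
    ← add_mul, ← Complex.ofReal_add]
  congr 3
  rw [norm_add_sq_real, inner_add_right, inner_smul_right, inner_add_left, real_inner_comm η x]
  ring

theorem enorm_modulatedShift_integrand (w f : V → ℂ) (t : ℝ) (x η : V) :
    ‖modulationPhase t x η * (w η * f (x + (4 * π * t) • η))‖ₑ =
      ‖w η‖ₑ * ‖f (x + (4 * π * t) • η)‖ₑ := by
  rw [enorm_mul, enorm_mul, ← ofReal_norm (modulationPhase t x η),
    norm_modulationPhase, ENNReal.ofReal_one, one_mul]

end Oscillation

section ShiftedAverage

variable {V : Type*} [NormedAddCommGroup V] [InnerProductSpace ℝ V] [FiniteDimensional ℝ V]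
  [MeasurableSpace V] [BorelSpace V]

/-- Averaging a function over translates along a finite measure is bounded on `Lᵖ`. -/
theorem lintegral_rpow_lintegral_translate_le (ν : Measure V) [IsFiniteMeasure ν] (s : ℝ)
    {g : V → ℝ≥0∞} (hg : Measurable g) {p : ℝ} (hp : 1 ≤ p) :
    ∫⁻ x, (∫⁻ η, g (x + s • η) ∂ν) ^ p ≤ ν Set.univ ^ p * ∫⁻ x, g x ^ p := by
  have hp0 : 0 < p := by linarith
  have hjensen : ∀ x, (∫⁻ η, g (x + s • η) ∂ν) ^ p ≤
      ν Set.univ ^ (p - 1) * ∫⁻ η, g (x + s • η) ^ p ∂ν := by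
    intro x
    have h := eLpNorm'_le_eLpNorm'_mul_rpow_measure_univ (μ := ν) zero_lt_one hp
      (f := fun η => g (x + s • η))
      (hg.comp (by fun_prop : Measurable fun η : V => x + s • η)).aestronglyMeasurable
    simp only [eLpNorm'_eq_lintegral_enorm, enorm_eq_self, ENNReal.rpow_one, div_one] at h
    calc (∫⁻ η, g (x + s • η) ∂ν) ^ p
        ≤ ((∫⁻ η, g (x + s • η) ^ p ∂ν) ^ (1 / p) * ν Set.univ ^ (1 - 1 / p)) ^ p := by gcongr
      _ = ν Set.univ ^ (p - 1) * ∫⁻ η, g (x + s • η) ^ p ∂ν := by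
        rw [ENNReal.mul_rpow_of_nonneg _ _ hp0.le, ← ENNReal.rpow_mul, ← ENNReal.rpow_mul,
          one_div_mul_cancel hp0.ne', ENNReal.rpow_one, mul_comm, sub_mul, one_mul,
          one_div_mul_cancel hp0.ne']
  have hmeas : Measurable fun q : V × V => g (q.1 + s • q.2) ^ p :=
    (hg.comp (by fun_prop)).pow_const p
  calc ∫⁻ x, (∫⁻ η, g (x + s • η) ∂ν) ^ p
      ≤ ∫⁻ x, ν Set.univ ^ (p - 1) * ∫⁻ η, g (x + s • η) ^ p ∂ν := lintegral_mono hjensen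
    _ = ν Set.univ ^ (p - 1) * ∫⁻ η, (∫⁻ x, g (x + s • η) ^ p) ∂ν := by
      rw [lintegral_const_mul _ hmeas.lintegral_prod_right', lintegral_lintegral_swap]
      exact hmeas.aemeasurable
    _ = ν Set.univ ^ (p - 1) * (ν Set.univ ^ (1 : ℝ) * ∫⁻ x, g x ^ p) := by
      simp_rw [lintegral_add_right_eq_self (fun x => g x ^ p)]
      rw [lintegral_const, mul_comm (∫⁻ x, g x ^ p), ENNReal.rpow_one]
    _ = ν Set.univ ^ p * ∫⁻ x, g x ^ p := by
      rw [← mul_assoc, ← ENNReal.rpow_add_of_nonneg _ _ (by linarith) zero_le_one, sub_add_cancel]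

/-- The `w`-average of the conjugated modulations
`f ↦ e^{2πi x·η + 4π² i t |η|²} f(x + 4πtη)`. -/
noncomputable def modulatedShiftAverage (w : V → ℂ) (t : ℝ) (f : V → ℂ) (x : V) : ℂ :=
  ∫ η, modulationPhase t x η * (w η * f (x + (4 * π * t) • η))

variable {w : V → ℂ} {f g : V → ℂ}

theorem aestronglyMeasurable_modulatedShift_integrand (hw : Integrable w) (t : ℝ)
    (hf : StronglyMeasurable f) :
    AEStronglyMeasurable
      (fun q : V × V => modulationPhase t q.1 q.2 * (w q.2 * f (q.1 + (4 * π * t) • q.2)))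
      ((volume : Measure V).prod volume) :=
  (continuous_modulationPhase t).aestronglyMeasurable.mul
    (hw.aestronglyMeasurable.comp_snd.mul
      (hf.comp_measurable (by fun_prop)).aestronglyMeasurable)

theorem aestronglyMeasurable_modulatedShiftAverage (hw : Integrable w) (t : ℝ)
    (hf : StronglyMeasurable f) :
    AEStronglyMeasurable (modulatedShiftAverage w t f) volume :=
  (aestronglyMeasurable_modulatedShift_integrand hw t hf).integral_prod_right'

theorem lintegral_rpow_lintegral_shift_le (hw : Integrable w) (t : ℝ)
    (hf : StronglyMeasurable f) {p : ℝ} (hp : 1 ≤ p) :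
    ∫⁻ x, (∫⁻ η, ‖modulationPhase t x η * (w η * f (x + (4 * π * t) • η))‖ₑ) ^ p ≤
      (∫⁻ η, ‖w η‖ₑ) ^ p * ∫⁻ x, ‖f x‖ₑ ^ p := by
  have hfin : IsFiniteMeasure (volume.withDensity fun η => ‖w η‖ₑ) :=
    isFiniteMeasure_withDensity hw.2.ne
  have h := lintegral_rpow_lintegral_translate_le (volume.withDensity fun η => ‖w η‖ₑ)
    (4 * π * t) hf.enorm hp
  rw [withDensity_apply _ MeasurableSet.univ, Measure.restrict_univ] at h
  convert h using 4 with x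
  rw [lintegral_withDensity_eq_lintegral_mul₀ hw.aestronglyMeasurable.enorm]
  · simp only [enorm_modulatedShift_integrand, Pi.mul_apply]
  · exact (hf.enorm.comp (by fun_prop : Measurable fun η : V => x + (4 * π * t) • η)).aemeasurable

theorem eLpNorm_modulatedShiftAverage_le (hw : Integrable w) (t : ℝ)
    (hf : StronglyMeasurable f) {p : ℝ≥0∞} (hp : 1 ≤ p) (hp' : p ≠ ⊤) :
    eLpNorm (modulatedShiftAverage w t f) p volume ≤
      ENNReal.ofReal (∫ ξ, ‖w ξ‖) * eLpNorm f p volume := by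
  have hp1 : 1 ≤ p.toReal := by
    simpa using (ENNReal.toReal_le_toReal ENNReal.one_ne_top hp').2 hp
  have hp0 : p ≠ 0 := (zero_lt_one.trans_le hp).ne'
  rw [eLpNorm_eq_lintegral_rpow_enorm_toReal hp0 hp',
    eLpNorm_eq_lintegral_rpow_enorm_toReal hp0 hp', ofReal_integral_norm_eq_lintegral_enorm hw]
  calc (∫⁻ x, ‖modulatedShiftAverage w t f x‖ₑ ^ p.toReal) ^ (1 / p.toReal)
      ≤ ((∫⁻ η, ‖w η‖ₑ) ^ p.toReal * ∫⁻ x, ‖f x‖ₑ ^ p.toReal) ^ (1 / p.toReal) := by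
        gcongr
        refine le_trans (lintegral_mono fun x => ?_) (lintegral_rpow_lintegral_shift_le hw t hf hp1)
        gcongr
        exact enorm_integral_le_lintegral_enorm _
    _ = _ := by
        rw [ENNReal.mul_rpow_of_nonneg _ _ (by positivity), ← ENNReal.rpow_mul,
          mul_one_div_cancel (by linarith), ENNReal.rpow_one]

theorem ae_integrable_modulatedShift (hw : Integrable w) (t : ℝ)
    (hf : StronglyMeasurable f) (hf2 : MemLp f 2 volume) :
    ∀ᵐ x, Integrable fun η => modulationPhase t x η * (w η * f (x + (4 * π * t) • η)) := by
  have hmeas := aestronglyMeasurable_modulatedShift_integrand hw t hf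
  have hlt : ∫⁻ x, (∫⁻ η, ‖modulationPhase t x η * (w η * f (x + (4 * π * t) • η))‖ₑ) ^ (2 : ℝ)
      ≠ ⊤ := by
    refine ne_top_of_le_ne_top ?_ (lintegral_rpow_lintegral_shift_le hw t hf one_le_two)
    refine ENNReal.mul_ne_top (ENNReal.rpow_ne_top_of_nonneg zero_le_two hw.2.ne) ?_
    simpa using (lintegral_rpow_enorm_lt_top_of_eLpNorm_lt_top two_ne_zero ENNReal.ofNat_ne_top
      hf2.2).ne
  filter_upwards [ae_lt_top' (hmeas.enorm.lintegral_prod_right'.pow_const _) hlt,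
    hmeas.prodMk_left] with x hx hxm
  exact ⟨hxm, (ENNReal.rpow_lt_top_iff_of_pos zero_lt_two).1 hx⟩

theorem modulatedShiftAverage_sub_ae (hw : Integrable w) (t : ℝ)
    (hf : StronglyMeasurable f) (hf2 : MemLp f 2 volume)
    (hg : StronglyMeasurable g) (hg2 : MemLp g 2 volume) :
    modulatedShiftAverage w t (f - g) =ᵐ[volume]
      modulatedShiftAverage w t f - modulatedShiftAverage w t g := by
  filter_upwards [ae_integrable_modulatedShift hw t hf hf2,
    ae_integrable_modulatedShift hw t hg hg2] with x hfx hgx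
  simp only [modulatedShiftAverage, Pi.sub_apply]
  rw [← integral_sub hfx hgx]
  simp only [mul_sub]

end ShiftedAverage

section FourierSide

open ContinuousLinearMap (mul)

variable {V : Type*} [NormedAddCommGroup V] [InnerProductSpace ℝ V] [FiniteDimensional ℝ V]
  [MeasurableSpace V] [BorelSpace V] {w : V → ℂ}

theorem continuous_fourierInv (hw : Integrable w) : Continuous (𝓕⁻ w) := by
  rw [show 𝓕⁻ w = fun x => 𝓕 w (-x) from funext (Real.fourierInv_eq_fourier_neg w)]
  exact (VectorFourier.fourierIntegral_continuous Real.continuous_fourierChar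
    (by exact continuous_inner) hw).comp continuous_neg

theorem norm_fourierInv_le (w : V → ℂ) (x : V) : ‖𝓕⁻ w x‖ ≤ ∫ ξ, ‖w ξ‖ := by
  rw [Real.fourierInv_eq_fourier_neg]
  exact VectorFourier.norm_fourierIntegral_le_integral_norm _ _ _ _ _

theorem memLp_top_fourierInv (hw : Integrable w) : MemLp (𝓕⁻ w) ⊤ volume :=
  memLp_top_of_bound (continuous_fourierInv hw).aestronglyMeasurable _
    (ae_of_all _ (norm_fourierInv_le w))

theorem integrable_fourierInv_mul_schwartz (hw : Integrable w) (g : 𝓢(V, ℂ)) :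
    Integrable fun x => 𝓕⁻ w x * g x :=
  g.integrable.bdd_mul (continuous_fourierInv hw).aestronglyMeasurable
    (ae_of_all _ (norm_fourierInv_le w))

theorem fourier_fourierInv_mul_schwartz (hw : Integrable w) (g : 𝓢(V, ℂ)) :
    𝓕 (fun x => 𝓕⁻ w x * g x) = w ⋆[mul ℂ ℂ] (𝓕 g : 𝓢(V, ℂ)) := by
  have hinv : 𝓕⁻ (w ⋆[mul ℂ ℂ] (𝓕 g : 𝓢(V, ℂ))) = fun x => 𝓕⁻ w x * g x := by
    ext x
    rw [Real.fourierInv_eq_fourier_neg, Real.fourier_mul_convolution_eq hw (𝓕 g).integrable,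
      ← Real.fourierInv_eq_fourier_neg, ← Real.fourierInv_eq_fourier_neg,
      ← SchwartzMap.fourierInv_coe, FourierTransform.fourierInv_fourier_eq]
  have hcont : Continuous (w ⋆[mul ℂ ℂ] (𝓕 g : 𝓢(V, ℂ))) :=
    BddAbove.continuous_convolution_right_of_integrable _
      ⟨_, Set.forall_mem_range.2 (SchwartzMap.norm_le_seminorm ℝ (𝓕 g))⟩ hw (𝓕 g).continuous
  have hfour : 𝓕 (w ⋆[mul ℂ ℂ] (𝓕 g : 𝓢(V, ℂ))) = fun x => 𝓕⁻ w (-x) * g (-x) := by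
    ext x
    rw [← congrFun hinv (-x), Real.fourierInv_eq_fourier_neg, neg_neg]
  rw [← hinv]
  refine hcont.fourier_fourierInv_eq (hw.integrable_convolution _ (𝓕 g).integrable) ?_
  rw [hfour]
  exact (integrable_fourierInv_mul_schwartz hw g).comp_neg

/-- Conjugating convolution with `w` by the Schrödinger symbol on the Fourier side yields the
modulated shift average. -/
theorem fourierInv_schrodingerSymbol_mul_convolution (hw : Integrable w) (t : ℝ) (φ : 𝓢(V, ℂ))
    (x : V) :
    𝓕⁻ (fun ξ => schrodingerSymbol (-t) ξ *
      (w ⋆[mul ℂ ℂ] fun ζ => schrodingerSymbol t ζ * (𝓕 φ : 𝓢(V, ℂ)) ζ) ξ) x =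
      modulatedShiftAverage w t φ x := by
  set h : V → ℂ := fun ζ => schrodingerSymbol t ζ * (𝓕 φ : 𝓢(V, ℂ)) ζ with hh
  have hint : Integrable h := (𝓕 φ).integrable.bdd_mul
    (continuous_schrodingerSymbol t).aestronglyMeasurable
    (ae_of_all _ fun ξ => (norm_schrodingerSymbol t ξ).le)
  have hprod : Integrable
      (fun q : V × V => ((𝐞 (inner ℝ q.1 x) : ℂ) * schrodingerSymbol (-t) q.1) *
        (w q.2 * h (q.1 - q.2))) ((volume : Measure V).prod volume) := by
    refine (hw.convolution_integrand (mul ℂ ℂ) hint).bdd_mul (c := 1) ?_ (ae_of_all _ fun q => ?_)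
    · refine Continuous.aestronglyMeasurable (Continuous.mul ?_ ?_)
      · exact continuous_subtype_val.comp (Real.continuous_fourierChar.comp (by fun_prop))
      · exact (continuous_schrodingerSymbol _).comp continuous_fst
    · rw [norm_mul, norm_schrodingerSymbol, Circle.norm_coe, one_mul]
  calc _ = ∫ ξ, ∫ η, ((𝐞 (inner ℝ ξ x) : ℂ) * schrodingerSymbol (-t) ξ) * (w η * h (ξ - η)) := by
        rw [Real.fourierInv_eq]
        refine integral_congr_ae (ae_of_all _ fun ξ => ?_)
        simp only [convolution_def, ContinuousLinearMap.mul_apply', Circle.smul_def, smul_eq_mul]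
        rw [integral_const_mul, mul_assoc]
    _ = ∫ η, ∫ ξ, ((𝐞 (inner ℝ ξ x) : ℂ) * schrodingerSymbol (-t) ξ) * (w η * h (ξ - η)) :=
        integral_integral_swap hprod
    _ = modulatedShiftAverage w t φ x := by
        refine integral_congr_ae (ae_of_all _ fun η => ?_)
        simp only
        rw [← integral_add_right_eq_self _ η]
        have hφ : φ (x + (4 * π * t) • η) =
            ∫ ζ, (𝐞 (inner ℝ ζ (x + (4 * π * t) • η)) : ℂ) * (𝓕 φ : 𝓢(V, ℂ)) ζ := by
          have hinv : 𝓕⁻ (𝓕 φ : 𝓢(V, ℂ)) = φ := FourierTransform.fourierInv_fourier_eq φ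
          conv_lhs => rw [← hinv, SchwartzMap.fourierInv_coe, Real.fourierInv_eq]
          rfl
        rw [hφ, ← integral_const_mul, ← integral_const_mul]
        refine integral_congr_ae (ae_of_all _ fun ζ => ?_)
        simp only [hh, add_sub_cancel_right]
        linear_combination (w η * (𝓕 φ : 𝓢(V, ℂ)) ζ) * schrodingerSymbol_neg_mul_shift t x ζ η

/-- `U t` acts on nice functions as the free Schrödinger propagator. -/
def IsSchrodingerPropagator
    (U : ℝ → (Lp ℂ 2 (volume : Measure V) →L[ℂ] Lp ℂ 2 (volume : Measure V))) : Prop :=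
  ∀ t : ℝ, ∀ f : V → ℂ, Integrable f volume → ∀ hf2 : MemLp f 2 volume,
    Integrable (𝓕 f) volume →
      (U t (hf2.toLp f) : V → ℂ) =ᵐ[volume] 𝓕⁻ fun ξ => schrodingerSymbol t ξ * 𝓕 f ξ

variable {U : ℝ → (Lp ℂ 2 (volume : Measure V) →L[ℂ] Lp ℂ 2 (volume : Measure V))}

theorem IsSchrodingerPropagator.exists_schwartz (hU : IsSchrodingerPropagator U) (t : ℝ)
    (φ : 𝓢(V, ℂ)) :
    ∃ g : 𝓢(V, ℂ), (U t (φ.toLp 2 volume) : V → ℂ) =ᵐ[volume] g ∧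
      ((𝓕 g : 𝓢(V, ℂ)) : V → ℂ) = fun ξ => schrodingerSymbol t ξ * (𝓕 φ : 𝓢(V, ℂ)) ξ := by
  refine ⟨𝓕⁻ (SchwartzMap.smulLeftCLM ℂ (schrodingerSymbol t) (𝓕 φ)), ?_, ?_⟩
  · refine (hU t φ φ.integrable (φ.memLp 2) (𝓕 φ).integrable).trans ?_
    rw [SchwartzMap.fourierInv_coe,
      SchwartzMap.smulLeftCLM_apply (hasTemperateGrowth_schrodingerSymbol t)]
    rfl
  · rw [FourierTransform.fourier_fourierInv_eq,
      SchwartzMap.smulLeftCLM_apply (hasTemperateGrowth_schrodingerSymbol t)]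
    rfl

/-- Multiplication by `W ∈ L^∞`, conjugated by the propagator. -/
noncomputable def conjugatedMultiplier
    (U : ℝ → (Lp ℂ 2 (volume : Measure V) →L[ℂ] Lp ℂ 2 (volume : Measure V)))
    (W : Lp ℂ ⊤ (volume : Measure V)) (t : ℝ) :
    Lp ℂ 2 (volume : Measure V) →L[ℂ] Lp ℂ 2 (volume : Measure V) :=
  U (-t) ∘L ((mul ℂ ℂ).holderL volume ⊤ 2 2 W) ∘L U t

theorem conjugatedMultiplier_apply (W : Lp ℂ ⊤ (volume : Measure V)) (t : ℝ)
    (f : Lp ℂ 2 (volume : Measure V)) :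
    conjugatedMultiplier U W t f = U (-t) ((mul ℂ ℂ).holder 2 W (U t f)) :=
  rfl

theorem IsSchrodingerPropagator.conjugatedMultiplier_schwartz (hU : IsSchrodingerPropagator U)
    (hw : Integrable w) (t : ℝ) (φ : 𝓢(V, ℂ)) :
    (conjugatedMultiplier U ((memLp_top_fourierInv hw).toLp _) t (φ.toLp 2 volume) : V → ℂ) =ᵐ[volume]
      modulatedShiftAverage w t φ := by
  obtain ⟨g, hg, hgF⟩ := hU.exists_schwartz t φ
  have h2 : MemLp (fun x => 𝓕⁻ w x * g x) 2 volume := (g.memLp 2).mul (memLp_top_fourierInv hw)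
  have hmul : (mul ℂ ℂ).holder 2 ((memLp_top_fourierInv hw).toLp _) (U t (φ.toLp 2 volume)) =
      h2.toLp _ := by
    refine Lp.ext ?_
    filter_upwards [(mul ℂ ℂ).coeFn_holder (r := 2) ((memLp_top_fourierInv hw).toLp _)
      (U t (φ.toLp 2 volume)), h2.coeFn_toLp, hg, (memLp_top_fourierInv hw).coeFn_toLp] with x h1 h2 h3 h4
    rw [h1, h2, h3, h4, ContinuousLinearMap.mul_apply']
  have hF := fourier_fourierInv_mul_schwartz hw g
  rw [conjugatedMultiplier_apply, hmul]
  refine (hU (-t) _ (integrable_fourierInv_mul_schwartz hw g) h2 ?_).trans (ae_of_all _ fun x => ?_)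
  · rw [hF]
    exact hw.integrable_convolution _ (𝓕 g).integrable
  · rw [hF, hgF]
    exact fourierInv_schrodingerSymbol_mul_convolution hw t φ x

theorem IsSchrodingerPropagator.conjugatedMultiplier_ae_eq (hU : IsSchrodingerPropagator U)
    (hw : Integrable w) (t : ℝ) (f : Lp ℂ 2 (volume : Measure V)) :
    (conjugatedMultiplier U ((memLp_top_fourierInv hw).toLp _) t f : V → ℂ) =ᵐ[volume]
      modulatedShiftAverage w t f := by
  set B := conjugatedMultiplier U ((memLp_top_fourierInv hw).toLp _) t
  have hmeas := aestronglyMeasurable_modulatedShiftAverage hw t (Lp.stronglyMeasurable f)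
  have hbound : ∀ φ : 𝓢(V, ℂ), eLpNorm ((B f : V → ℂ) - modulatedShiftAverage w t f) 2 volume ≤
      (‖B‖ₑ + ENNReal.ofReal (∫ ξ, ‖w ξ‖)) * ‖f - φ.toLp 2 volume‖ₑ := by
    intro φ
    have hφf := modulatedShiftAverage_sub_ae hw t φ.continuous.stronglyMeasurable (φ.memLp 2)
      (Lp.stronglyMeasurable f) (Lp.memLp f)
    have hsplit : (B f : V → ℂ) - modulatedShiftAverage w t f =ᵐ[volume]
        (B (f - φ.toLp 2 volume) : V → ℂ) + modulatedShiftAverage w t ((φ : V → ℂ) - (f : V → ℂ)) := by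
      rw [map_sub]
      filter_upwards [hφf, Lp.coeFn_sub (B f) (B (φ.toLp 2 volume)),
        hU.conjugatedMultiplier_schwartz hw t φ] with x h1 h2 h3
      simp only [Pi.sub_apply, Pi.add_apply] at h1 h2 ⊢
      rw [h1, h2, h3]
      ring
    have hφf_norm : eLpNorm ((φ : V → ℂ) - (f : V → ℂ)) 2 volume = ‖f - φ.toLp 2 volume‖ₑ := by
      rw [← enorm_neg, neg_sub, Lp.enorm_def]
      refine eLpNorm_congr_ae ?_
      filter_upwards [Lp.coeFn_sub (φ.toLp 2 volume) f, φ.coeFn_toLp 2 volume] with x h1 h2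
      rw [h1, Pi.sub_apply, Pi.sub_apply, h2]
    have hsm : StronglyMeasurable ((φ : V → ℂ) - (f : V → ℂ)) :=
      φ.continuous.stronglyMeasurable.sub (Lp.stronglyMeasurable f)
    rw [eLpNorm_congr_ae hsplit, add_mul]
    refine (eLpNorm_add_le (Lp.aestronglyMeasurable _)
      (aestronglyMeasurable_modulatedShiftAverage hw t hsm) one_le_two).trans (add_le_add ?_ ?_)
    · rw [← Lp.enorm_def]
      exact B.le_opENorm _
    · rw [← hφf_norm]
      exact eLpNorm_modulatedShiftAverage_le hw t hsm one_le_two ENNReal.ofNat_ne_top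
  have hzero : eLpNorm ((B f : V → ℂ) - modulatedShiftAverage w t f) 2 volume = 0 := by
    obtain ⟨u, hu, hlim⟩ := mem_closure_iff_seq_limit.1
      (SchwartzMap.denseRange_toLpCLM (F := ℂ) (p := 2) (μ := (volume : Measure V))
        ENNReal.ofNat_ne_top f)
    choose φ hφ using hu
    have hsub : Filter.Tendsto (fun k => ‖f - u k‖ₑ) Filter.atTop (nhds 0) := by
      simpa using ((tendsto_const_nhds (x := f)).sub hlim).enorm
    have hC : ‖B‖ₑ + ENNReal.ofReal (∫ ξ, ‖w ξ‖) ≠ ⊤ :=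
      ENNReal.add_ne_top.2 ⟨enorm_ne_top, ENNReal.ofReal_ne_top⟩
    have hmul := ENNReal.Tendsto.const_mul hsub (Or.inr hC)
    rw [mul_zero] at hmul
    refine le_antisymm (ge_of_tendsto' hmul fun k => ?_) zero_le
    rw [← hφ k]
    exact hbound (φ k)
  rw [eLpNorm_eq_zero_iff ((Lp.aestronglyMeasurable _).sub hmeas) two_ne_zero] at hzero
  exact Filter.eventuallyEq_iff_sub.2 hzero

end FourierSide

/-- Journé–Soffer–Sogge type estimate.  Let `n ≥ 1`, let `W : ℝⁿ → ℂ` be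
(a.e.) the inverse Fourier transform of an integrable function `w`, and let
`U : ℝ → B(L²(ℝⁿ))` be the free Schrödinger group `e^{iΔt}`, characterized as the family
of unitary operators acting as the Fourier multiplier with symbol `e^{-4π² i t |ξ|²}`
(this is encoded by the hypothesis `hU_mult` on the dense set of functions `f` with
`f ∈ L¹ ∩ L²` and `𝓕 f ∈ L¹`, together with unitarity `hU_norm`).  Then for every
`t ∈ ℝ`, every `1 ≤ p < ∞` and every `f ∈ L² ∩ Lᵖ`, the function `U_{-t}(W · U_t f)`
belongs to `Lᵖ` and `‖U_{-t}(W · U_t f)‖_{Lᵖ} ≤ ‖w‖_{L¹} ‖f‖_{Lᵖ}`. -/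
theorem jss_conjugated_multiplier_estimate
    (n : ℕ) (hn : 1 ≤ n)
    (W w : EuclideanSpace ℝ (Fin n) → ℂ)
    (hw : Integrable w (volume : Measure (EuclideanSpace ℝ (Fin n))))
    (hW : W =ᵐ[(volume : Measure (EuclideanSpace ℝ (Fin n)))] FourierTransformInv.fourierInv w)
    (U : ℝ → (Lp ℂ 2 (volume : Measure (EuclideanSpace ℝ (Fin n))) →L[ℂ]
      Lp ℂ 2 (volume : Measure (EuclideanSpace ℝ (Fin n)))))
    (hU_norm : ∀ t : ℝ, ∀ f, ‖U t f‖ = ‖f‖)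
    (hU_mult : ∀ t : ℝ, ∀ f : EuclideanSpace ℝ (Fin n) → ℂ,
      Integrable f volume → ∀ hf2 : MemLp f 2 volume,
      Integrable (FourierTransform.fourier f) volume →
      (U t (hf2.toLp f) : EuclideanSpace ℝ (Fin n) → ℂ) =ᵐ[volume]
        FourierTransformInv.fourierInv
          (fun ξ : EuclideanSpace ℝ (Fin n) => Complex.exp ((((-4) * π ^ 2 * t * ‖ξ‖ ^ 2 : ℝ) : ℂ) * Complex.I) *
            FourierTransform.fourier f ξ)) :
    ∀ t : ℝ, ∀ p : ℝ≥0∞, 1 ≤ p → p ≠ ⊤ →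
      ∀ f : EuclideanSpace ℝ (Fin n) → ℂ, ∀ hf2 : MemLp f 2 volume, MemLp f p volume →
        ∃ hWUf : MemLp (fun x => W x * (U t (hf2.toLp f) : EuclideanSpace ℝ (Fin n) → ℂ) x)
            2 volume,
          MemLp (U (-t) (hWUf.toLp _) : EuclideanSpace ℝ (Fin n) → ℂ) p volume ∧
          eLpNorm (U (-t) (hWUf.toLp _) : EuclideanSpace ℝ (Fin n) → ℂ) p volume ≤
            ENNReal.ofReal (∫ ξ, ‖w ξ‖) * eLpNorm f p volume := by
  intro t p hp hp' f hf2 hfp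
  have hU : IsSchrodingerPropagator U := hU_mult
  have hWUf : MemLp (fun x => W x * (U t (hf2.toLp f) : EuclideanSpace ℝ (Fin n) → ℂ) x)
      2 volume :=
    (Lp.memLp _).mul ((memLp_congr_ae hW).2 (memLp_top_fourierInv hw))
  have hconj : U (-t) (hWUf.toLp _) =
      conjugatedMultiplier U ((memLp_top_fourierInv hw).toLp _) t (hf2.toLp f) := by
    refine congrArg (U (-t)) (Lp.ext ?_)
    filter_upwards [hWUf.coeFn_toLp, hW, (memLp_top_fourierInv hw).coeFn_toLp,
      (ContinuousLinearMap.mul ℂ ℂ).coeFn_holder (r := 2) ((memLp_top_fourierInv hw).toLp _)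
        (U t (hf2.toLp f))] with x h1 h2 h3 h4
    refine h1.trans (Eq.trans ?_ h4.symm)
    rw [h2, h3, ContinuousLinearMap.mul_apply']
  have hle : eLpNorm (U (-t) (hWUf.toLp _) : EuclideanSpace ℝ (Fin n) → ℂ) p volume ≤
      ENNReal.ofReal (∫ ξ, ‖w ξ‖) * eLpNorm f p volume := by
    rw [hconj, eLpNorm_congr_ae (hU.conjugatedMultiplier_ae_eq hw t _),
      ← eLpNorm_congr_ae hf2.coeFn_toLp]
    exact eLpNorm_modulatedShiftAverage_le hw t (Lp.stronglyMeasurable _) hp hp'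
  exact ⟨hWUf, ⟨Lp.aestronglyMeasurable _,
    hle.trans_lt (ENNReal.mul_lt_top ENNReal.ofReal_lt_top hfp.2)⟩, hle⟩
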